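/- arXiv:1606.07465 — 4 statements merged into one kernel-verified Lean document; each statement's English description precedes it below -/
import Mathlib

section
/- Let H be a separable complex Hilbert space and let P : ℝ → (H →L[ℂ] H) be a monotone family of orthogonal projections, i.e. each P t is self-adjoint and idempotent and P t ∘ P s = P s whenever s ≤ t. Then the set of points of strong discontinuity, { t ∈ ℝ : there exists x ∈ H such that the map s ↦ P s x is not continuous at t }, is countable. -/
section ProjectionFamily

variable {H : Type*} [NormedAddCommGroup H] [InnerProductSpace ℂ H] [CompleteSpace H]

theorem norm_sub_sq_of_comp_eq {p q : H →L[ℂ] H}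
    (hp : ContinuousLinearMap.adjoint p = p) (hq : ContinuousLinearMap.adjoint q = q)
    (hqq : q.comp q = q) (hpq : p.comp q = q) (x : H) :
    ‖p x - q x‖ ^ 2 = ‖p x‖ ^ 2 - ‖q x‖ ^ 2 := by
  have h : inner ℂ (p x) (q x) = inner ℂ (q x) (q x) := by
    calc inner ℂ (p x) (q x) = inner ℂ x (p (q x)) := by
          conv_lhs => rw [← hp]
          rw [ContinuousLinearMap.adjoint_inner_left]
      _ = inner ℂ x (q (q x)) := by
          rw [← ContinuousLinearMap.comp_apply p, ← ContinuousLinearMap.comp_apply q, hpq, hqq]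
      _ = inner ℂ (q x) (q x) := by
          conv_rhs => enter [2]; rw [← hq]
          rw [ContinuousLinearMap.adjoint_inner_left]
  have hre : RCLike.re (inner ℂ (p x) (q x)) = ‖q x‖ ^ 2 := by
    rw [h, norm_sq_eq_re_inner (𝕜 := ℂ)]
  rw [norm_sub_sq (𝕜 := ℂ), hre]
  ring

theorem norm_apply_le_of_adjoint_eq_of_comp_self {q : H →L[ℂ] H}
    (hq : ContinuousLinearMap.adjoint q = q) (hqq : q.comp q = q) (x : H) :
    ‖q x‖ ≤ ‖x‖ := by
  have h := norm_sub_sq_of_comp_eq (p := ContinuousLinearMap.id ℂ H)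
    ContinuousLinearMap.adjoint_id hq hqq (ContinuousLinearMap.id_comp q) x
  simp only [ContinuousLinearMap.id_apply] at h
  exact le_of_sq_le_sq (by nlinarith [sq_nonneg ‖x - q x‖]) (norm_nonneg x)

end ProjectionFamily

/-- For a family of contractions, continuity at a point passes from a dense set of vectors to all
vectors. -/
theorem continuousAt_apply_of_dense {T E : Type*} [TopologicalSpace T] [NormedAddCommGroup E]
    [NormedSpace ℂ E] {P : T → E →L[ℂ] E} (hP : ∀ t x, ‖P t x‖ ≤ ‖x‖) {D : Set E} (hD : Dense D)
    {t : T} (h : ∀ y ∈ D, ContinuousAt (fun s => P s y) t) (x : E) :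
    ContinuousAt (fun s => P s x) t := by
  rw [Metric.continuousAt_iff']
  intro ε hε
  obtain ⟨y, hyD, hy⟩ := hD.exists_dist_lt x (show 0 < ε / 3 by positivity)
  filter_upwards [Metric.continuousAt_iff'.1 (h y hyD) (ε / 3) (by positivity)] with s hs
  have hcontr (r : T) : dist (P r x) (P r y) ≤ dist x y := by
    simpa only [dist_eq_norm, map_sub] using hP r (x - y)
  have h₁ := hcontr s
  have h₂ := hcontr t
  have h₃ := dist_triangle4 (P s x) (P s y) (P t y) (P t x)
  rw [dist_comm (P t y)] at h₃
  linarith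

/-- On a separable complex Hilbert space, a monotone family of orthogonal
projections indexed by `ℝ` has only countably many points of strong
discontinuity. -/
theorem stmt_4 {H : Type*} [NormedAddCommGroup H] [InnerProductSpace ℂ H]
    [CompleteSpace H] [TopologicalSpace.SeparableSpace H]
    (P : ℝ → H →L[ℂ] H)
    (hsa : ∀ t, ContinuousLinearMap.adjoint (P t) = P t)
    (hidem : ∀ t, (P t).comp (P t) = P t)
    (hmono : ∀ s t : ℝ, s ≤ t → (P t).comp (P s) = P s) :
    {t : ℝ | ∃ x : H, ¬ ContinuousAt (fun s => P s x) t}.Countable := by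
  obtain ⟨D, hDc, hD⟩ := TopologicalSpace.exists_countable_dense H
  have hpyth {s t : ℝ} (hst : s ≤ t) (x : H) :
      ‖P t x - P s x‖ ^ 2 = ‖P t x‖ ^ 2 - ‖P s x‖ ^ 2 :=
    norm_sub_sq_of_comp_eq (hsa t) (hsa s) (hidem s) (hmono s t hst) x
  have hg (x : H) : Monotone fun t => ‖P t x‖ ^ 2 := fun s t hst => by
    have := hpyth hst x
    have := sq_nonneg ‖P t x - P s x‖
    show ‖P s x‖ ^ 2 ≤ ‖P t x‖ ^ 2
    linarith
  have hdist (x : H) (s t : ℝ) : ‖P s x - P t x‖ ^ 2 = |‖P s x‖ ^ 2 - ‖P t x‖ ^ 2| := by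
    rcases le_total s t with hst | hst
    · rw [norm_sub_rev, abs_sub_comm, ← hpyth hst, abs_of_nonneg (sq_nonneg _)]
    · rw [← hpyth hst, abs_of_nonneg (sq_nonneg _)]
  refine (hDc.biUnion fun x _ => (hg x).countable_not_continuousAt).mono ?_
  rintro t ⟨x, hx⟩
  by_contra ht
  simp only [Set.mem_iUnion, Set.mem_ofPred_eq, not_exists, not_not] at ht
  refine hx (continuousAt_apply_of_dense
    (fun s => norm_apply_le_of_adjoint_eq_of_comp_self (hsa s) (hidem s)) hD ?_ x)
  intro y hy
  rw [Metric.continuousAt_iff']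
  intro ε hε
  filter_upwards [Metric.continuousAt_iff'.1 (ht y hy) (ε ^ 2) (by positivity)] with s hs
  rw [Real.dist_eq, ← hdist] at hs
  rw [dist_eq_norm]
  exact lt_of_pow_lt_pow_left₀ 2 hε.le hs
end

section
/- Let H = lp (fun _ : ℝ => ℂ) 2 be the (non-separable) Hilbert space ℓ²(ℝ; ℂ), and for each t ∈ ℝ let P t : H →L[ℂ] H be the coordinate projection given by (P t x)(s) = x(s) if s ≤ t and (P t x)(s) = 0 if s > t. Then: (i) each P t is self-adjoint and idempotent; (ii) the family is monotone, i.e. P t ∘ P s = P s whenever s ≤ t; and (iii) for every t ∈ ℝ, taking x = lp.single 2 t 1 one has P s x = 0 for all s < t while P t x = x ≠ 0, so the map s ↦ P s x is not continuous at t. Hence the set of points of strong discontinuity of this monotone family of orthogonal projections is all of ℝ, which is uncountable. -/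
/-- On the non-separable Hilbert space `ℓ²(ℝ; ℂ)`, the family of coordinate
projections `P t` (cutting off coordinates beyond `t`) is a monotone family of
orthogonal projections whose set of points of strong discontinuity is all of
`ℝ`, hence uncountable. -/
theorem stmt_5 (P : ℝ → (lp (fun _ : ℝ => ℂ) 2 →L[ℂ] lp (fun _ : ℝ => ℂ) 2))
    (hP : ∀ (t : ℝ) (x : lp (fun _ : ℝ => ℂ) 2) (s : ℝ),
      (P t x : ∀ _ : ℝ, ℂ) s = if s ≤ t then (x : ∀ _ : ℝ, ℂ) s else 0) :
    (∀ t, ContinuousLinearMap.adjoint (P t) = P t) ∧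
    (∀ t, (P t).comp (P t) = P t) ∧
    (∀ s t : ℝ, s ≤ t → (P t).comp (P s) = P s) ∧
    (∀ t : ℝ,
      (∀ s : ℝ, s < t →
        P s (lp.single (E := fun _ : ℝ => ℂ) 2 t 1) = 0) ∧
      P t (lp.single (E := fun _ : ℝ => ℂ) 2 t 1) =
        lp.single (E := fun _ : ℝ => ℂ) 2 t 1 ∧
      lp.single (E := fun _ : ℝ => ℂ) 2 t 1 ≠ 0 ∧
      ¬ ContinuousAt
        (fun s => P s (lp.single (E := fun _ : ℝ => ℂ) 2 t 1)) t) ∧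
    {t : ℝ | ∃ x : lp (fun _ : ℝ => ℂ) 2,
        ¬ ContinuousAt (fun s => P s x) t} = Set.univ ∧
    ¬ {t : ℝ | ∃ x : lp (fun _ : ℝ => ℂ) 2,
        ¬ ContinuousAt (fun s => P s x) t}.Countable := by
  have apply_single_of_lt (s t : ℝ) (hst : s < t) :
      P s (lp.single (E := fun _ : ℝ => ℂ) 2 t 1) = 0 := by
    ext r
    rw [hP]
    split_ifs with hr
    · exact lp.single_apply_ne 2 t _ (hr.trans_lt hst).ne
    · rfl
  have apply_single_self (t : ℝ) : P t (lp.single (E := fun _ : ℝ => ℂ) 2 t 1) =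
      lp.single (E := fun _ : ℝ => ℂ) 2 t 1 := by
    ext r
    rw [hP]
    split_ifs with hr
    · rfl
    · exact (lp.single_apply_ne (E := fun _ : ℝ => ℂ) 2 t 1 (not_le.1 hr).ne').symm
  have single_ne_zero (t : ℝ) : lp.single (E := fun _ : ℝ => ℂ) 2 t 1 ≠ 0 := by
    intro h
    have h_apply := lp.single_apply_self (E := fun _ : ℝ => ℂ) 2 t 1
    rw [h] at h_apply
    exact zero_ne_one h_apply
  have comp_of_le (s t : ℝ) (hst : s ≤ t) : (P t).comp (P s) = P s := by
    ext x r
    simp only [ContinuousLinearMap.comp_apply, hP]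
    grind
  have not_continuousAt (t : ℝ) : ¬ ContinuousAt
      (fun s => P s (lp.single (E := fun _ : ℝ => ℂ) 2 t 1)) t := by
    intro h
    have h_left := h.tendsto.mono_left (nhdsWithin_le_nhds (s := Set.Iio t))
    have h_zero : Filter.Tendsto (fun s => P s (lp.single (E := fun _ : ℝ => ℂ) 2 t 1))
        (nhdsWithin t (Set.Iio t)) (nhds 0) :=
      tendsto_const_nhds.congr' <| Filter.eventuallyEq_of_mem self_mem_nhdsWithin
        fun s hs => (apply_single_of_lt s t hs).symm
    exact single_ne_zero t <| (apply_single_self t).symm.trans (tendsto_nhds_unique h_left h_zero)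
  have discontinuities_eq_univ : {t : ℝ | ∃ x : lp (fun _ : ℝ => ℂ) 2,
      ¬ ContinuousAt (fun s => P s x) t} = Set.univ :=
    Set.eq_univ_of_forall fun t => ⟨_, not_continuousAt t⟩
  refine ⟨fun t => ?_, fun t => comp_of_le t t le_rfl, comp_of_le,
    fun t => ⟨fun s => apply_single_of_lt s t, apply_single_self t, single_ne_zero t,
      not_continuousAt t⟩, discontinuities_eq_univ, ?_⟩
  · refine ((ContinuousLinearMap.eq_adjoint_iff _ _).2 fun x y => ?_).symm
    rw [lp.inner_eq_tsum, lp.inner_eq_tsum]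
    refine tsum_congr fun r => ?_
    rw [hP, hP]
    split_ifs <;> simp
  · rw [discontinuities_eq_univ]
    exact Cardinal.not_countable_real
end

section
/- Let H be a separable complex Hilbert space and let P : ℝ → (H →L[ℂ] H) be a monotone family of orthogonal projections (each P t self-adjoint and idempotent, P t ∘ P s = P s for s ≤ t) which is strongly right-continuous: for every t and x, P s x → P t x as s → t from the right. For each n, let π^n = { 0 = π^n_0 < π^n_1 < ⋯ < π^n_{k_n} } be a finite partition of [0, π^n_{k_n}] such that π^n_{k_n} → ∞ and the mesh max_j (π^n_j − π^n_{j−1}) → 0 as n → ∞, and define the discrete family P_n(t) := P(π^n_j), where π^n_j is the largest partition point with π^n_j ≤ t (and P_n(t) := 0 for t < π^n_0 = 0 understood as P(0)). Then there exists a countable set D ⊆ ℝ such that for every t ∈ [0, ∞) \ D and every x ∈ H, P_n(t) x → P(t) x in norm as n → ∞. -/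
open Filter

section MonotoneProjections

variable {H : Type*} [NormedAddCommGroup H] [InnerProductSpace ℂ H] [CompleteSpace H]

/-- Increments of a monotone family of orthogonal projections satisfy the Pythagorean identity. -/
lemma norm_sub_sq_of_monotone_projections {P : ℝ → H →L[ℂ] H}
    (hsa : ∀ t, ContinuousLinearMap.adjoint (P t) = P t)
    (hmono : ∀ s t : ℝ, s ≤ t → (P t).comp (P s) = P s) {s t : ℝ} (hst : s ≤ t) (x : H) :
    ‖P t x - P s x‖ ^ 2 = ‖P t x‖ ^ 2 - ‖P s x‖ ^ 2 := by
  have move (r : ℝ) (u v : H) : inner ℂ (P r u) v = inner ℂ u (P r v) := by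
    conv_lhs => rw [← hsa r, ContinuousLinearMap.adjoint_inner_left]
  have absorb {a b : ℝ} (hab : a ≤ b) (u : H) : P b (P a u) = P a u :=
    congrArg (fun T : H →L[ℂ] H => T u) (hmono a b hab)
  have hcross : inner ℂ (P t x) (P s x) = inner ℂ (P s x) (P s x) := by
    rw [move t, absorb hst, move s, absorb le_rfl]
  rw [@norm_sub_sq ℂ, hcross, inner_self_eq_norm_sq]
  ring

lemma monotone_norm_sq_of_monotone_projections {P : ℝ → H →L[ℂ] H}
    (hsa : ∀ t, ContinuousLinearMap.adjoint (P t) = P t)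
    (hmono : ∀ s t : ℝ, s ≤ t → (P t).comp (P s) = P s) (x : H) :
    Monotone fun t => ‖P t x‖ ^ 2 := fun s t hst => by
  have h := norm_sub_sq_of_monotone_projections hsa hmono hst x
  have := sq_nonneg ‖P t x - P s x‖
  dsimp only
  linarith

lemma continuousAt_apply_of_continuousAt_norm_sq {P : ℝ → H →L[ℂ] H}
    (hsa : ∀ t, ContinuousLinearMap.adjoint (P t) = P t)
    (hmono : ∀ s t : ℝ, s ≤ t → (P t).comp (P s) = P s) {t : ℝ} {x : H}
    (hc : ContinuousAt (fun s => ‖P s x‖ ^ 2) t) : ContinuousAt (fun s => P s x) t := by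
  have key (s : ℝ) : ‖P s x - P t x‖ = √|‖P s x‖ ^ 2 - ‖P t x‖ ^ 2| := by
    rw [← Real.sqrt_sq (norm_nonneg (P s x - P t x))]
    congr 1
    rcases le_total s t with h | h
    · rw [norm_sub_rev, abs_sub_comm, ← norm_sub_sq_of_monotone_projections hsa hmono h x,
        abs_sq]
    · rw [← norm_sub_sq_of_monotone_projections hsa hmono h x, abs_sq]
  rw [ContinuousAt, tendsto_iff_norm_sub_tendsto_zero]
  simp only [key]
  have := ((hc.sub_const (‖P t x‖ ^ 2)).abs).sqrt
  simpa [ContinuousAt] using this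

lemma norm_apply_le_of_projection {T : H →L[ℂ] H}
    (hsa : ContinuousLinearMap.adjoint T = T) (hidem : T.comp T = T) (x : H) :
    ‖T x‖ ≤ ‖x‖ := by
  have hproj : IsStarProjection T := ⟨hidem, hsa⟩
  simpa using T.le_of_opNorm_le hproj.norm_le x

/-- A monotone family of orthogonal projections on a separable space is strongly continuous off a
countable set. -/
lemma exists_countable_continuousAt_of_monotone_projections
    [TopologicalSpace.SeparableSpace H] {P : ℝ → H →L[ℂ] H}
    (hsa : ∀ t, ContinuousLinearMap.adjoint (P t) = P t)
    (hmono : ∀ s t : ℝ, s ≤ t → (P t).comp (P s) = P s) :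
    ∃ D : Set ℝ, D.Countable ∧ ∀ t ∉ D, ∀ x : H, ContinuousAt (fun s => P s x) t := by
  obtain ⟨S, hS, hdense⟩ := TopologicalSpace.exists_countable_dense H
  refine ⟨⋃ y ∈ S, {t | ¬ ContinuousAt (fun s => ‖P s y‖ ^ 2) t}, hS.biUnion fun y _ =>
    (monotone_norm_sq_of_monotone_projections hsa hmono y).countable_not_continuousAt, ?_⟩
  intro t ht x
  simp only [Set.mem_iUnion, Set.mem_ofPred_eq, not_exists, not_not] at ht
  rw [Metric.continuousAt_iff']
  intro ε hε
  obtain ⟨y, hyS, hy⟩ := hdense.exists_dist_lt x (show 0 < ε / 3 by positivity)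
  have hcy := continuousAt_apply_of_continuousAt_norm_sq hsa hmono (ht y hyS)
  filter_upwards [Metric.continuousAt_iff'.1 hcy (ε / 3) (by positivity)] with s hs
  have contract (r : ℝ) : dist (P r x) (P r y) ≤ dist x y := by
    rw [dist_eq_norm, dist_eq_norm, ← map_sub]
    exact norm_apply_le_of_projection (hsa r) (hmono r r le_rfl) _
  have h := dist_triangle4 (P s x) (P s y) (P t y) (P t x)
  have h₁ := contract s
  have h₂ := contract t
  rw [dist_comm] at h₂
  linarith

end MonotoneProjections

/-- The largest partition points below `t` converge to `t` when the partitions exhaust `[0, ∞)`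
and their meshes tend to zero. -/
lemma tendsto_largest_partition_point {π : ℕ → ℕ → ℝ} {k : ℕ → ℕ}
    (hstrict : ∀ n, ∀ j < k n, π n j < π n (j + 1))
    (hinf : Tendsto (fun n => π n (k n)) atTop atTop)
    (hmesh : ∀ ε > 0, ∃ N : ℕ, ∀ n ≥ N, ∀ j < k n, π n (j + 1) - π n j < ε)
    {t : ℝ} {j : ℕ → ℕ} (hj : ∀ n, j n ≤ k n) (hle : ∀ n, π n (j n) ≤ t)
    (hmax : ∀ n, ∀ i ≤ k n, π n i ≤ t → π n i ≤ π n (j n)) :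
    Tendsto (fun n => π n (j n)) atTop (nhds t) := by
  rw [Metric.tendsto_nhds]
  intro ε hε
  obtain ⟨N, hN⟩ := hmesh ε hε
  filter_upwards [eventually_ge_atTop N, hinf.eventually_gt_atTop t] with n hn hlast
  have hlt : j n < k n := by
    refine lt_of_le_of_ne (hj n) fun h => ?_
    exact absurd (hle n) (by rw [h]; exact not_le.2 hlast)
  have hnext : t < π n (j n + 1) := by
    by_contra! h
    exact absurd (hmax n _ hlt h) (not_le.2 (hstrict n _ hlt))
  have := hN n hn _ hlt
  rw [dist_comm, Real.dist_eq, abs_of_nonneg (sub_nonneg.2 (hle n))]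
  linarith

/-- Discrete approximation of a strongly right-continuous monotone family of
orthogonal projections on a separable complex Hilbert space: sampling the
family along finite partitions whose right endpoints tend to infinity and whose
meshes tend to zero produces discrete families converging strongly to the
original one at all but countably many points of `[0, ∞)`. -/
theorem stmt_6 {H : Type*} [NormedAddCommGroup H] [InnerProductSpace ℂ H]
    [CompleteSpace H] [TopologicalSpace.SeparableSpace H]
    (P : ℝ → H →L[ℂ] H)
    (hsa : ∀ t, ContinuousLinearMap.adjoint (P t) = P t)
    (hidem : ∀ t, (P t).comp (P t) = P t)
    (hmono : ∀ s t : ℝ, s ≤ t → (P t).comp (P s) = P s)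
    (hrc : ∀ (t : ℝ) (x : H),
      Tendsto (fun s => P s x) (nhdsWithin t (Set.Ioi t)) (nhds (P t x)))
    -- the partitions: for each `n`, `π n 0 = 0 < π n 1 < ⋯ < π n (k n)`
    (π : ℕ → ℕ → ℝ) (k : ℕ → ℕ)
    (hzero : ∀ n, π n 0 = 0)
    (hstrict : ∀ n, ∀ j < k n, π n j < π n (j + 1))
    (hinf : Tendsto (fun n => π n (k n)) atTop atTop)
    (hmesh : ∀ ε > 0, ∃ N : ℕ, ∀ n ≥ N, ∀ j < k n, π n (j + 1) - π n j < ε)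
    -- the discrete families: `Pd n t = P (π n j)` where `π n j` is the largest
    -- partition point with `π n j ≤ t`
    (Pd : ℕ → ℝ → H →L[ℂ] H)
    (hPd : ∀ (n : ℕ) (t : ℝ), 0 ≤ t → ∃ j ≤ k n, π n j ≤ t ∧
      (∀ i ≤ k n, π n i ≤ t → π n i ≤ π n j) ∧ Pd n t = P (π n j)) :
    ∃ D : Set ℝ, D.Countable ∧
      ∀ t ∈ Set.Ici (0 : ℝ) \ D, ∀ x : H,
        Tendsto (fun n => Pd n t x) atTop (nhds (P t x)) := by
  obtain ⟨D, hD, hcont⟩ := exists_countable_continuousAt_of_monotone_projections hsa hmono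
  refine ⟨D, hD, fun t ht x => ?_⟩
  choose j hj hle hmax heq using fun n => hPd n t ht.1
  simp only [heq]
  exact (hcont t ht.2 x).tendsto.comp
    (tendsto_largest_partition_point hstrict hinf hmesh hj hle hmax)
end

section
/- Let K be a complex Hilbert space, A a non-unital complex star algebra, and π : A → (K →L[ℂ] K) a non-unital star-algebra homomorphism. Let V : K →L[ℂ] K be such that π(a) ∘ ((adjoint V) ∘ V) = π(a) for every a ∈ A. Then the map Ψ : A → (K →L[ℂ] K) defined by Ψ(a) = V ∘ π(a) ∘ (adjoint V) is ℂ-linear, multiplicative (Ψ(a b) = Ψ(a) ∘ Ψ(b) for all a, b ∈ A), and star-preserving (Ψ(star a) = adjoint (Ψ a) for all a ∈ A); that is, Ψ is a non-unital star-algebra homomorphism. -/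
/-- If `π` is a non-unital *-homomorphism from a non-unital complex star
algebra `A` into the bounded operators on a complex Hilbert space `K`, and
`V` is an operator with `π a ∘ (V* ∘ V) = π a` for all `a`, then
`a ↦ V ∘ π a ∘ V*` is again linear, multiplicative and star-preserving, i.e. a
non-unital *-homomorphism. -/
theorem stmt_8 {K : Type*} [NormedAddCommGroup K] [InnerProductSpace ℂ K]
    [CompleteSpace K] {A : Type*} [NonUnitalRing A] [Module ℂ A]
    [StarRing A] [StarModule ℂ A]
    (π : A →⋆ₙₐ[ℂ] (K →L[ℂ] K)) (V : K →L[ℂ] K)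
    (hV : ∀ a : A, (π a).comp ((ContinuousLinearMap.adjoint V).comp V) = π a) :
    (∀ (c : ℂ) (a b : A),
        V.comp ((π (c • a + b)).comp (ContinuousLinearMap.adjoint V)) =
          c • V.comp ((π a).comp (ContinuousLinearMap.adjoint V)) +
            V.comp ((π b).comp (ContinuousLinearMap.adjoint V))) ∧
    (∀ a b : A,
        V.comp ((π (a * b)).comp (ContinuousLinearMap.adjoint V)) =
          (V.comp ((π a).comp (ContinuousLinearMap.adjoint V))).comp
            (V.comp ((π b).comp (ContinuousLinearMap.adjoint V)))) ∧
    (∀ a : A,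
        V.comp ((π (star a)).comp (ContinuousLinearMap.adjoint V)) =
          ContinuousLinearMap.adjoint
            (V.comp ((π a).comp (ContinuousLinearMap.adjoint V)))) := by
  refine ⟨fun c a b => ?_, fun a b => ?_, fun a => ?_⟩
  · ext x
    simp [map_add, map_smul]
  · ext x
    have h := DFunLike.congr_fun (hV a) (π b (ContinuousLinearMap.adjoint V x))
    simp only [ContinuousLinearMap.comp_apply] at h
    simp [map_mul, h]
  · rw [map_star, ContinuousLinearMap.star_eq_adjoint, ContinuousLinearMap.adjoint_comp,
      ContinuousLinearMap.adjoint_comp, ContinuousLinearMap.adjoint_adjoint,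
      ContinuousLinearMap.comp_assoc]
end
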